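/- For a regular cardinal κ, if a partial order B has the κ-Freese-Nation property and A ≤_κ B, then A also has the κ-Freese-Nation property. -/

import Mathlib

universe u v

open Cardinal

/-- `f` is a κ-Freese-Nation mapping on the partial order `P`. -/
def IsFNMap (κ : Cardinal.{u}) {P : Type u} [PartialOrder P] (f : P → Set P) : Prop :=
  (∀ a, #(f a) < κ) ∧
    ∀ a b : P, a ≤ b → ∃ c, c ∈ f a ∧ c ∈ f b ∧ a ≤ c ∧ c ≤ b

/-- The partial order `P` has the κ-Freese-Nation property. -/
def HasFN (κ : Cardinal.{u}) (P : Type u) [PartialOrder P] : Prop :=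
  ∃ f : P → Set P, IsFNMap κ f

/-- `A` is a κ-substructure of the ambient partial order `P`: for every `b : P`,
`{a ∈ A | a ≤ b}` has a cofinal subset of size `< κ` and `{a ∈ A | b ≤ a}` has a
coinitial subset of size `< κ`. -/
def SubKappa (κ : Cardinal.{u}) {P : Type u} [PartialOrder P] (A : Set P) : Prop :=
  ∀ b : P,
    (∃ U : Set P, U ⊆ A ∧ #U < κ ∧ (∀ u ∈ U, u ≤ b) ∧
      (∀ a ∈ A, a ≤ b → ∃ u ∈ U, a ≤ u)) ∧
    (∃ V : Set P, V ⊆ A ∧ #V < κ ∧ (∀ v ∈ V, b ≤ v) ∧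
      (∀ a ∈ A, b ≤ a → ∃ v ∈ V, v ≤ a))

/-- `A ≤_κ B` for two subsets of an ambient partial order:
`A ⊆ B` and `A` is a κ-substructure of the suborder `B`. -/
def RelSubKappa (κ : Cardinal.{u}) {P : Type u} [PartialOrder P] (A B : Set P) : Prop :=
  A ⊆ B ∧ SubKappa κ {x : B | (x : P) ∈ A}


/-- For regular κ, if B has the κ-FN and A ≤_κ B then A has the κ-FN. -/
theorem statement4 (κ : Cardinal.{u}) (hκ : κ.IsRegular) {B : Type u} [PartialOrder B]
    (A : Set B) (hB : HasFN κ B) (hA : SubKappa κ A) : HasFN κ ↥A := by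
  obtain ⟨f, hf, hfn⟩ := hB
  choose U hUA hUκ hUle hUcof using fun b => (hA b).1
  refine ⟨fun a => Subtype.val ⁻¹' ⋃ c ∈ f a, U c, fun a => ?_, fun a b hab => ?_⟩
  · refine (mk_preimage_of_injective _ _ Subtype.val_injective).trans_lt ?_
    exact (card_biUnion_lt_iff_forall_of_isRegular hκ (hf a)).2 fun c _ => hUκ c
  · obtain ⟨c, hca, hcb, hac, hcb'⟩ := hfn a b hab
    obtain ⟨u, hu, hau⟩ := hUcof c a a.2 hac
    exact ⟨⟨u, hUA c hu⟩, Set.mem_biUnion hca hu, Set.mem_biUnion hcb hu, hau,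
      (hUle c u hu).trans hcb'⟩
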